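/- Let I ⊆ R be a nonzero, proper S_n-invariant monomial ideal. Then: (i) reg(R/I) = max{|μ^+| : μ ∈ Λ*(I)}; and (ii) pd(R/I) = max{n − ℓ(μ) : μ ∈ Λ*(I)}. -/

import Mathlib

open scoped BigOperators

noncomputable section
open Classical

/-! ## Generic (labeled) simplicial chain complexes and reduced homology over a field -/

section Homology

variable (K : Type) [Field K] {α : Type}

/-- Index type for chains: elements of `S` whose face (second component) has `j` elements. -/
def ChainIdx (S : Set (α × Finset ℕ)) (j : ℕ) : Type :=
  {q : α × Finset ℕ // q ∈ S ∧ q.2.card = j}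

/-- The boundary of a basis element, with the usual simplicial signs. -/
noncomputable def bdElt (S : Set (α × Finset ℕ)) (j : ℕ) (q : ChainIdx S (j + 1)) :
    ChainIdx S j →₀ K :=
  ∑ v ∈ q.1.2,
    if h : (q.1.1, q.1.2.erase v) ∈ S ∧ (q.1.2.erase v).card = j then
      ((-1 : K) ^ (q.1.2.filter (fun u => u ≤ v)).card) •
        Finsupp.single (⟨(q.1.1, q.1.2.erase v), h⟩ : ChainIdx S j) (1 : K)
    else 0

/-- The simplicial boundary map. -/
noncomputable def bd (S : Set (α × Finset ℕ)) (j : ℕ) :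
    (ChainIdx S (j + 1) →₀ K) →ₗ[K] (ChainIdx S j →₀ K) :=
  Finsupp.linearCombination K (bdElt K S j)

/-- Cycles in homological degree `j` (chains are indexed by the cardinality of faces;
degree `j` corresponds to reduced topological degree `j - 1`). -/
noncomputable def cycles (S : Set (α × Finset ℕ)) : (j : ℕ) → Submodule K (ChainIdx S j →₀ K)
  | 0 => ⊤
  | (i + 1) => LinearMap.ker (bd K S i)

/-- `rhd K S j` is the dimension of the reduced homology group `H̃_{j-1}` of the complex `S`
(the chain groups being finite dimensional, this is `dim` cycles `- dim` boundaries). -/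
noncomputable def rhd (S : Set (α × Finset ℕ)) (j : ℕ) : ℕ :=
  Module.finrank K (cycles K S j) -
    Module.finrank K (LinearMap.range (bd K S j) ⊓ cycles K S j : Submodule K _)

/-- `hdim K S j = dim_K H̃_j(S; K)`, for `j : ℤ` (zero for `j ≤ -2`). -/
noncomputable def hdim (S : Set (α × Finset ℕ)) (j : ℤ) : ℕ :=
  if 0 ≤ j + 1 then rhd K S (j + 1).toNat else 0

/-- View an unlabeled collection of faces as a labeled one (labels in `Unit`). -/
def lab (Δ : Set (Finset ℕ)) : Set (Unit × Finset ℕ) := {q | q.2 ∈ Δ}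

/-- Dimension of reduced homology `H̃_{j-1}(Δ; K)` of a collection `Δ` of finite sets. -/
noncomputable def rhd0 (Δ : Set (Finset ℕ)) (j : ℕ) : ℕ := rhd K (lab Δ) j

/-- Dimension of reduced homology `H̃_j(Δ; K)`, `j : ℤ`. -/
noncomputable def hdim0 (Δ : Set (Finset ℕ)) (j : ℤ) : ℕ := hdim K (lab Δ) j

end Homology

/-! ## Monomial ideals in `k[x_1, …, x_n]`, invariant under the symmetric group -/

section Poly

variable (K : Type) [Field K] (n : ℕ)

/-- The monomial `x^a` in `k[x_1, …, x_n]`. -/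
noncomputable def mon (a : Fin n → ℕ) : MvPolynomial (Fin n) K :=
  MvPolynomial.monomial (Finsupp.equivFunOnFinite.symm a) 1

/-- A monomial ideal: an ideal generated by a set of monomials. -/
def IsMonomialIdeal (I : Ideal (MvPolynomial (Fin n) K)) : Prop :=
  ∃ S : Set (Fin n → ℕ), I = Ideal.span (mon K n '' S)

/-- `I` is invariant under the action of `S_n` permuting the variables. -/
def IsSymmetricIdeal (I : Ideal (MvPolynomial (Fin n) K)) : Prop :=
  ∀ σ : Equiv.Perm (Fin n), Ideal.map (MvPolynomial.rename σ).toRingHom I = I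

end Poly

/-! ## Partitions given by blocks `(d_1^{p_1}, …, d_s^{p_s}, 0^{p_{s+1}})` -/

section Blocks

/-- `cumsum p k = p 0 + ⋯ + p (k-1)`. -/
def cumsum (p : ℕ → ℕ) (k : ℕ) : ℕ := ∑ j ∈ Finset.range k, p j

/-- The index of the block (among blocks `0, …, s`) containing position `i`,
for blocks of sizes `p 0, …, p (s-1)` followed by a final block. -/
def blkOf (p : ℕ → ℕ) (s i : ℕ) : ℕ :=
  ((Finset.range s).filter fun k => cumsum p (k + 1) ≤ i).card

/-- The partition `μ = (d_0^{p_0}, …, d_{s-1}^{p_{s-1}}, 0^{p_s})` (0-indexed blocks),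
as a function of the position `i ∈ {0, …, n-1}` where `n = cumsum p (s+1)`. -/
def muOf (s : ℕ) (d p : ℕ → ℕ) (i : ℕ) : ℕ :=
  if blkOf p s i < s then d (blkOf p s i) else 0

/-- The partition `μ ∖ c`, obtained from `μ` by replacing, for each `k`, the last `c k` of
the parts equal to `d k` by `d k - 1`. -/
def muMinus (s : ℕ) (d p c : ℕ → ℕ) (i : ℕ) : ℕ :=
  if blkOf p s i < s then
    (if p (blkOf p s i) - c (blkOf p s i) ≤ i - cumsum p (blkOf p s i) then
      d (blkOf p s i) - 1 else d (blkOf p s i))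
  else 0

/-- Indicator vector of a finite set `F`. -/
def eF (F : Finset ℕ) (j : ℕ) : ℕ := if j ∈ F then 1 else 0

end Blocks

/-! ## The simplicial complexes `Δ^{μ,c}(I)` and `Γ^{μ,c}(I)` -/

section Complexes

variable (K : Type) [Field K] (n : ℕ)

/-- The simplicial complex `Δ^{μ,c}(I) = {F ⊆ [s] : μ ∖ (c + e_F) ∈ P(I)}` (vertices are
`0, …, s-1`), for `μ = (d_0^{p_0}, …, d_{s-1}^{p_{s-1}}, 0^{p_s})` and `c ≤ p(μ)`. -/
def DeltaCx (I : Ideal (MvPolynomial (Fin n) K)) (s : ℕ) (d p c : ℕ → ℕ) :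
    Set (Finset ℕ) :=
  {F | F ⊆ Finset.range s ∧
    mon K n (fun i => muMinus s d p (fun j => c j + eF F j) i.val) ∈ I}

/-- The Alexander dual complex `Γ^{μ,c}(I) = {F ⊆ [s] : μ ∖ (c + e_{[s]∖F}) ∈ O(I)}`. -/
def GammaCx (I : Ideal (MvPolynomial (Fin n) K)) (s : ℕ) (d p c : ℕ → ℕ) :
    Set (Finset ℕ) :=
  {F | F ⊆ Finset.range s ∧
    mon K n (fun i => muMinus s d p
      (fun j => c j + (if j < s ∧ j ∉ F then 1 else 0)) i.val) ∉ I}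

/-- `γ_i^{μ,c}(I) = dim_K H̃_{i-1}(Δ^{μ,c}(I); K)`. -/
noncomputable def gammaDim (I : Ideal (MvPolynomial (Fin n) K)) (s : ℕ) (d p c : ℕ → ℕ)
    (i : ℕ) : ℕ :=
  rhd0 K (DeltaCx K n I s d p c) i

end Complexes

/-! ## Multigraded Tor via the Koszul complex

For a monomial ideal `I`, the multidegree-`a` strand of the Koszul complex `K_•(I)` is the
(shifted) reduced chain complex of the simplicial complex
`Δ_a^I = {F ⊆ [n] : a - e_F ≥ 0, x^{a - e_F} ∈ I}`, so that
`dim_K Tor_i(I, K)_a = dim_K H̃_{i-1}(Δ_a^I; K)`, and similarly for `R/I` with the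
condition `x^{a-e_F} ∉ I`. -/

section Tor

variable (K : Type) [Field K] (n : ℕ)

/-- The Koszul simplicial complex of the ideal `I` in multidegree `a`. -/
def KosI (I : Ideal (MvPolynomial (Fin n) K)) (a : Fin n → ℕ) : Set (Finset ℕ) :=
  {F | F ⊆ Finset.range n ∧ (∀ i : Fin n, (i : ℕ) ∈ F → 1 ≤ a i) ∧
    mon K n (fun i => a i - eF F i.val) ∈ I}

/-- The Koszul complex of `R/I` in multidegree `a`. -/
def KosQ (I : Ideal (MvPolynomial (Fin n) K)) (a : Fin n → ℕ) : Set (Finset ℕ) :=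
  {F | F ⊆ Finset.range n ∧ (∀ i : Fin n, (i : ℕ) ∈ F → 1 ≤ a i) ∧
    mon K n (fun i => a i - eF F i.val) ∉ I}

/-- `dim_K Tor_i(I, K)_a`, for a monomial ideal `I` and a multidegree `a ∈ ℤ^n`
(components with a negative coordinate vanish, so only `a ∈ ℕ^n` is needed). -/
noncomputable def torDim (I : Ideal (MvPolynomial (Fin n) K)) (i : ℕ) (a : Fin n → ℕ) : ℕ :=
  rhd0 K (KosI K n I a) i

/-- `dim_K Tor_i(R/I, K)_a` for a monomial ideal `I`. -/
noncomputable def torQDim (I : Ideal (MvPolynomial (Fin n) K)) (i : ℕ) (a : Fin n → ℕ) : ℕ :=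
  rhd0 K (KosQ K n I a) i

/-- `dim_K Tor_i(I, K)_{⟨μ⟩}`: the sum of `dim_K Tor_i(I, K)_a` over all rearrangements `a`
of the partition `μ`. -/
noncomputable def torDimSym (I : Ideal (MvPolynomial (Fin n) K)) (i : ℕ) (μ : Fin n → ℕ) : ℕ :=
  ∑ a ∈ Finset.image (fun σ : Equiv.Perm (Fin n) => μ ∘ σ) Finset.univ, torDim K n I i a

/-- `dim_K Tor_i(R/I, K)_{⟨μ⟩}`. -/
noncomputable def torQDimSym (I : Ideal (MvPolynomial (Fin n) K)) (i : ℕ) (μ : Fin n → ℕ) : ℕ :=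
  ∑ a ∈ Finset.image (fun σ : Equiv.Perm (Fin n) => μ ∘ σ) Finset.univ, torQDim K n I i a

end Tor

/-! ## Extended partitions in `P_n^∞` and the dual generators of an `S_n`-invariant
monomial ideal -/

section ExtendedPartitions

variable (K : Type) [Field K] (n : ℕ)

/-- `ℓ(μ)`: the number of entries of `μ ∈ P_n^∞` equal to `∞`. -/
def ellInf (μ : Fin n → ℕ∞) : ℕ := (Finset.univ.filter fun i => μ i = ⊤).card

/-- The largest finite entry of `μ ∈ P_n^∞` (i.e. the first finite entry, `μ` being
weakly decreasing). -/
def topVal (μ : Fin n → ℕ∞) : ℕ := Finset.univ.sup fun i => (μ i).toNat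

/-- `μ^+ ∈ P_n`: each `∞` entry of `μ` is replaced by (largest finite entry)` + 1`. -/
def plusOf (μ : Fin n → ℕ∞) (i : Fin n) : ℕ :=
  if μ i = ⊤ then topVal n μ + 1 else (μ i).toNat

/-- `μ̃ = μ^+ + (0^{ℓ(μ)}, 1^{n - ℓ(μ)}) ∈ P_n`. -/
def tildeOf (μ : Fin n → ℕ∞) (i : Fin n) : ℕ :=
  if μ i = ⊤ then topVal n μ + 1 else (μ i).toNat + 1

/-- The ideal `Q_μ = ∩_{σ ∈ S_n} σ((x_k^{μ_k + 1}, …, x_n^{μ_n + 1}))`, where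
`μ_k, …, μ_n` are the finite entries of `μ ∈ P_n^∞`. -/
noncomputable def Qgen (μ : Fin n → ℕ∞) : Ideal (MvPolynomial (Fin n) K) :=
  ⨅ σ : Equiv.Perm (Fin n),
    Ideal.map (MvPolynomial.rename σ).toRingHom
      (Ideal.span {g | ∃ i : Fin n, μ i ≠ ⊤ ∧ g = MvPolynomial.X i ^ ((μ i).toNat + 1)})

/-- `Λ` is the (finite) set of dual generators of `I`, i.e. `I = ∩_{μ ∈ Λ} Q_μ` is the
irredundant presentation of `I` by ideals `Q_μ`. -/
def IsDualPresentation (I : Ideal (MvPolynomial (Fin n) K))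
    (Λ : Finset (Fin n → ℕ∞)) : Prop :=
  (∀ μ ∈ Λ, Antitone μ) ∧ (I = ⨅ μ ∈ Λ, Qgen K n μ) ∧
    ∀ μ ∈ Λ, I ≠ ⨅ ρ ∈ Λ, ⨅ _ : ρ ≠ μ, Qgen K n ρ

/-- The partial order `≼` on dual generators: `μ ≼ ρ` iff `μ̃ ≤ ρ̃` (componentwise) and
`ℓ(μ) - ℓ(ρ) ≤ |ρ̃| - |μ̃|`. -/
def preceq (μ ρ : Fin n → ℕ∞) : Prop :=
  (∀ i, tildeOf n μ i ≤ tildeOf n ρ i) ∧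
    (∑ i, tildeOf n μ i) + ellInf n μ ≤ (∑ i, tildeOf n ρ i) + ellInf n ρ

/-- The extended partition `ρ = (∞^{p_0}, d_1^{p_1}, …, d_s^{p_s}) ∈ P_n^∞`
(so `n = p 0 + p 1 + ⋯ + p s`), as a function of the position `i ∈ {0, …, n-1}`. -/
def rhoOf (s : ℕ) (d p : ℕ → ℕ) (i : ℕ) : ℕ∞ :=
  if blkOf p (s + 1) i = 0 then ⊤ else ((d (blkOf p (s + 1) i) : ℕ) : ℕ∞)

end ExtendedPartitions

/-! ### Two criteria on the homology of a collection of faces -/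

section Faces

variable (K : Type) [Field K]

/-- The sign with which `F.erase v` occurs in the boundary of `F`. -/
def faceSign (F : Finset ℕ) (v : ℕ) : K := (-1 : K) ^ (F.filter (fun u => u ≤ v)).card

/-- The basis chain of the face `F`, and zero if `F` is not a face with `j` elements. -/
def faceChain (Δ : Set (Finset ℕ)) (j : ℕ) (F : Finset ℕ) : ChainIdx (lab Δ) j →₀ K :=
  if h : ((), F) ∈ lab Δ ∧ F.card = j then
    Finsupp.single (⟨((), F), h⟩ : ChainIdx (lab Δ) j) (1 : K)
  else 0

variable {K}

lemma faceSign_mul_self (F : Finset ℕ) (v : ℕ) : faceSign K F v * faceSign K F v = 1 := by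
  unfold faceSign
  rw [← mul_pow]
  simp

lemma faceSign_ne_zero (F : Finset ℕ) (v : ℕ) : faceSign K F v ≠ 0 := by
  intro h
  simpa [h] using faceSign_mul_self (K := K) F v

lemma faceSign_erase_of_lt {F : Finset ℕ} {u v : ℕ} (hu : u ∈ F) (h : u < v) :
    faceSign K F v = -faceSign K (F.erase u) v := by
  unfold faceSign
  rw [Finset.filter_erase]
  have hm : u ∈ F.filter (fun t => t ≤ v) := Finset.mem_filter.2 ⟨hu, h.le⟩
  rw [← Finset.card_erase_add_one hm, pow_succ]
  ring

lemma faceSign_erase_of_gt {F : Finset ℕ} {u v : ℕ} (h : v < u) :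
    faceSign K (F.erase u) v = faceSign K F v := by
  unfold faceSign
  rw [Finset.filter_erase, Finset.erase_eq_of_notMem]
  simp [h]

lemma faceSign_mul_anticomm {F : Finset ℕ} {u v : ℕ} (hu : u ∈ F) (hv : v ∈ F) (h : u ≠ v) :
    faceSign K F u * faceSign K (F.erase u) v = -(faceSign K F v * faceSign K (F.erase v) u) := by
  rcases lt_or_gt_of_ne h with h | h
  · rw [faceSign_erase_of_gt h, faceSign_erase_of_lt hu h]
    ring
  · rw [faceSign_erase_of_gt h, faceSign_erase_of_lt hv h]
    ring

lemma faceChain_of_isFace {Δ : Set (Finset ℕ)} {j : ℕ} {F : Finset ℕ}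
    (h : ((), F) ∈ lab Δ ∧ F.card = j) :
    faceChain K Δ j F = Finsupp.single (⟨((), F), h⟩ : ChainIdx (lab Δ) j) (1 : K) :=
  dif_pos h

lemma faceChain_eq_zero {Δ : Set (Finset ℕ)} {j : ℕ} {F : Finset ℕ}
    (h : ¬ (((), F) ∈ lab Δ ∧ F.card = j)) : faceChain K Δ j F = 0 :=
  dif_neg h

lemma faceChain_coe {Δ : Set (Finset ℕ)} {j : ℕ} (q : ChainIdx (lab Δ) j) :
    faceChain K Δ j q.1.2 = Finsupp.single q 1 :=
  faceChain_of_isFace q.2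

lemma bdElt_lab {Δ : Set (Finset ℕ)} {j : ℕ} (q : ChainIdx (lab Δ) (j + 1)) :
    bdElt K (lab Δ) j q = ∑ v ∈ q.1.2, faceSign K q.1.2 v • faceChain K Δ j (q.1.2.erase v) := by
  refine Finset.sum_congr rfl fun v _ => ?_
  by_cases h : ((), q.1.2.erase v) ∈ lab Δ ∧ (q.1.2.erase v).card = j
  · rw [faceChain_of_isFace h]
    exact dif_pos h
  · rw [faceChain_eq_zero h, smul_zero]
    exact dif_neg h

lemma linearCombination_faceChain {Δ : Set (Finset ℕ)} {j : ℕ} {M : Type*} [AddCommGroup M]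
    [Module K M] (f : Finset ℕ → M) (F : Finset ℕ) :
    Finsupp.linearCombination K (fun q : ChainIdx (lab Δ) j => f q.1.2) (faceChain K Δ j F) =
      if F ∈ Δ ∧ F.card = j then f F else 0 := by
  by_cases h : F ∈ Δ ∧ F.card = j
  · rw [faceChain_of_isFace h, if_pos h]
    exact (Finsupp.linearCombination_single _ _ _).trans (one_smul _ _)
  · rw [faceChain_eq_zero h, if_neg h, map_zero]

lemma bd_eq_linearCombination (Δ : Set (Finset ℕ)) (j : ℕ) :
    bd K (lab Δ) j = Finsupp.linearCombination K (fun q : ChainIdx (lab Δ) (j + 1) =>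
      ∑ v ∈ q.1.2, faceSign K q.1.2 v • faceChain K Δ j (q.1.2.erase v)) := by
  unfold bd
  congr 1
  funext q
  exact bdElt_lab q

lemma bd_faceChain (Δ : Set (Finset ℕ)) (j : ℕ) (F : Finset ℕ) :
    bd K (lab Δ) j (faceChain K Δ (j + 1) F) =
      if F ∈ Δ ∧ F.card = j + 1 then
        ∑ v ∈ F, faceSign K F v • faceChain K Δ j (F.erase v) else 0 := by
  rw [bd_eq_linearCombination]
  exact linearCombination_faceChain
    (fun F => ∑ v ∈ F, faceSign K F v • faceChain K Δ j (F.erase v)) F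

/-- The value on the face `F` of the contracting homotopy which inserts the vertex `v`. -/
def coneFace (K : Type) [Field K] (Δ : Set (Finset ℕ)) (v j : ℕ) (F : Finset ℕ) :
    ChainIdx (lab Δ) (j + 1) →₀ K :=
  if v ∈ F then 0 else faceSign K (insert v F) v • faceChain K Δ (j + 1) (insert v F)

/-- The contracting homotopy which inserts the vertex `v`. -/
def coneMap (K : Type) [Field K] (Δ : Set (Finset ℕ)) (v j : ℕ) :
    (ChainIdx (lab Δ) j →₀ K) →ₗ[K] (ChainIdx (lab Δ) (j + 1) →₀ K) :=
  Finsupp.linearCombination K (fun q : ChainIdx (lab Δ) j => coneFace K Δ v j q.1.2)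

lemma bd_coneFace_of_notMem {Δ : Set (Finset ℕ)} {v j : ℕ} {F : Finset ℕ}
    (hup : ∀ F ∈ Δ, v ∉ F → insert v F ∈ Δ) (hF : F ∈ Δ) (hj : F.card = j) (hv : v ∉ F) :
    bd K (lab Δ) j (coneFace K Δ v j F) = faceChain K Δ j F +
      ∑ u ∈ F, (faceSign K (insert v F) v * faceSign K (insert v F) u) •
        faceChain K Δ j ((insert v F).erase u) := by
  have h1 : insert v F ∈ Δ ∧ (insert v F).card = j + 1 :=
    ⟨hup F hF hv, by rw [Finset.card_insert_of_notMem hv, hj]⟩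
  rw [coneFace, if_neg hv, map_smul, bd_faceChain, if_pos h1, Finset.sum_insert hv, smul_add,
    smul_smul, faceSign_mul_self, one_smul, Finset.erase_insert hv, Finset.smul_sum]
  simp only [smul_smul]

lemma coneMap_bd_add_bd_coneMap {Δ : Set (Finset ℕ)} {v j : ℕ}
    (hup : ∀ F ∈ Δ, v ∉ F → insert v F ∈ Δ)
    (hdown : ∀ F ∈ Δ, F.card = j + 1 → v ∈ F → F.erase v ∈ Δ) :
    bd K (lab Δ) (j + 1) ∘ₗ coneMap K Δ v (j + 1) + coneMap K Δ v j ∘ₗ bd K (lab Δ) j =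
      LinearMap.id := by
  refine Finsupp.lhom_ext' fun q => LinearMap.ext_ring ?_
  have hq : q.1.2 ∈ Δ := q.2.1
  have hc : q.1.2.card = j + 1 := q.2.2
  simp only [LinearMap.comp_apply, LinearMap.add_apply, Finsupp.lsingle_apply,
    LinearMap.id_apply, ← faceChain_coe]
  generalize q.1.2 = F at hq hc
  have hcone : coneMap K Δ v (j + 1) (faceChain K Δ (j + 1) F) = coneFace K Δ v (j + 1) F := by
    rw [coneMap, linearCombination_faceChain (coneFace K Δ v (j + 1)), if_pos ⟨hq, hc⟩]
  have hcone' : ∀ u ∈ F, coneMap K Δ v j (faceChain K Δ j (F.erase u)) =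
      if F.erase u ∈ Δ then coneFace K Δ v j (F.erase u) else 0 := by
    intro u hu
    rw [coneMap, linearCombination_faceChain (coneFace K Δ v j)]
    have : (F.erase u).card = j := by rw [Finset.card_erase_of_mem hu, hc]; rfl
    simp [this]
  rw [hcone, bd_faceChain, if_pos ⟨hq, hc⟩, map_sum]
  simp only [map_smul]
  by_cases hv : v ∈ F
  · rw [coneFace, if_pos hv, map_zero, zero_add, Finset.sum_eq_single v]
    · rw [hcone' v hv, if_pos (hdown F hq hc hv), coneFace, if_neg (Finset.notMem_erase v F),
        Finset.insert_erase hv, smul_smul, faceSign_mul_self, one_smul]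
    · intro u hu huv
      rw [hcone' u hu, coneFace, if_pos (Finset.mem_erase.2 ⟨huv.symm, hv⟩)]
      simp
    · exact fun h => absurd hv h
  · rw [bd_coneFace_of_notMem hup hq hc hv, add_assoc, ← Finset.sum_add_distrib,
      Finset.sum_eq_zero, add_zero]
    intro u hu
    have huv : u ≠ v := fun h => hv (h ▸ hu)
    have hve : v ∉ F.erase u := fun h => hv (Finset.mem_of_mem_erase h)
    have he : (insert v F).erase u = insert v (F.erase u) :=
      Finset.erase_insert_of_ne huv.symm
    have hcard : (insert v (F.erase u)).card = j + 1 := by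
      rw [Finset.card_insert_of_notMem hve, Finset.card_erase_of_mem hu, hc]; rfl
    rw [hcone' u hu, he, coneFace, if_neg hve]
    by_cases h : F.erase u ∈ Δ
    · have hs := faceSign_mul_anticomm (K := K) (F := insert v F) (u := u) (v := v)
        (Finset.mem_insert_of_mem hu) (Finset.mem_insert_self v F) huv
      rw [Finset.erase_insert hv, he] at hs
      rw [if_pos h, smul_smul, ← add_smul]
      have : faceSign K (insert v F) v * faceSign K (insert v F) u +
          faceSign K F u * faceSign K (insert v (F.erase u)) v = 0 := by
        have h1 := faceSign_mul_self (K := K) (insert v F) u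
        have h2 := faceSign_mul_self (K := K) F u
        linear_combination (faceSign K (insert v F) u * faceSign K F u) * hs
          - (faceSign K F u * faceSign K (insert v (F.erase u)) v) * h1
          - (faceSign K (insert v F) v * faceSign K (insert v F) u) * h2
      rw [this, zero_smul]
    · have h' : insert v (F.erase u) ∉ Δ := fun h' =>
        h (by simpa [Finset.erase_insert hve] using
          hdown _ h' hcard (Finset.mem_insert_self _ _))
      rw [if_neg h, faceChain_eq_zero fun hh => h' hh.1, smul_zero, smul_zero, zero_add]

/-- A collection of faces which is a cone with apex `v` in degree `j` has no homology there. -/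
lemma rhd0_eq_zero_of_cone {Δ : Set (Finset ℕ)} {v j : ℕ}
    (hup : ∀ F ∈ Δ, v ∉ F → insert v F ∈ Δ)
    (hdown : ∀ F ∈ Δ, F.card = j → v ∈ F → F.erase v ∈ Δ) : rhd0 K Δ j = 0 := by
  suffices h : cycles K (lab Δ) j ≤ LinearMap.range (bd K (lab Δ) j) by
    rw [rhd0, rhd, inf_eq_right.2 h, Nat.sub_self]
  intro z hz
  refine ⟨coneMap K Δ v j z, ?_⟩
  cases j with
  | zero =>
    suffices h : bd K (lab Δ) 0 ∘ₗ coneMap K Δ v 0 = LinearMap.id from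
      LinearMap.congr_fun h z
    refine Finsupp.lhom_ext' fun q => LinearMap.ext_ring ?_
    have hq : q.1.2 ∈ Δ := q.2.1
    have hc : q.1.2.card = 0 := q.2.2
    simp only [LinearMap.comp_apply, Finsupp.lsingle_apply, LinearMap.id_apply,
      ← faceChain_coe]
    generalize q.1.2 = F at hq hc
    have hF : F = ∅ := Finset.card_eq_zero.1 hc
    rw [coneMap, linearCombination_faceChain (coneFace K Δ v 0), if_pos ⟨hq, hc⟩,
      bd_coneFace_of_notMem hup hq hc (by simp [hF])]
    simp [hF]
  | succ j =>
    have h := LinearMap.congr_fun (coneMap_bd_add_bd_coneMap (K := K) hup hdown) z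
    have hz' : bd K (lab Δ) j z = 0 := hz
    simpa [hz'] using h

lemma exists_face_of_rhd0_ne_zero {Δ : Set (Finset ℕ)} {j : ℕ} (h : rhd0 K Δ j ≠ 0) :
    ∃ F ∈ Δ, F.card = j := by
  by_contra! hne
  have : IsEmpty (ChainIdx (lab Δ) j) := ⟨fun q => hne _ q.2.1 q.2.2⟩
  apply h
  rw [rhd0, rhd, Module.finrank_zero_of_subsingleton, Nat.zero_sub]

/-- A face none of whose facets are present is a cycle; it is not a boundary if the faces
around one of its facets `G.erase w` are all present. -/
lemma rhd0_ne_zero_of_facets {Δ : Set (Finset ℕ)} (hfin : Δ.Finite) {G : Finset ℕ} {w : ℕ}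
    (hG : G ∈ Δ) (hw : w ∈ G) (hfacet : ∀ u ∈ G, G.erase u ∉ Δ)
    (hlink : ∀ H ∈ Δ, ∀ x ∈ H, x ∉ G.erase w → G.erase w ⊆ H → insert x (G.erase w) ∈ Δ) :
    rhd0 K Δ G.card ≠ 0 := by
  obtain ⟨j, hj⟩ : ∃ j, G.card = j + 1 :=
    Nat.exists_eq_succ_of_ne_zero (Finset.card_ne_zero_of_mem hw)
  rw [hj]
  have : Finite (ChainIdx (lab Δ) (j + 1)) := by
    have := hfin.to_subtype
    refine Finite.of_injective (β := Δ) (fun q => ⟨q.1.2, q.2.1⟩) ?_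
    rintro ⟨⟨⟨⟩, F⟩, h⟩ ⟨⟨⟨⟩, F'⟩, h'⟩ hh
    obtain rfl : F = F' := congrArg Subtype.val hh
    rfl
  let c : Finset ℕ → K := fun H => ∑ x ∈ H, if H.erase x = G.erase w then faceSign K H x else 0
  let φ : (ChainIdx (lab Δ) (j + 1) →₀ K) →ₗ[K] K :=
    Finsupp.linearCombination K (fun q => c q.1.2)
  have hφ : φ ∘ₗ bd K (lab Δ) (j + 1) = 0 := by
    refine Finsupp.lhom_ext' fun q => LinearMap.ext_ring ?_
    have hq : q.1.2 ∈ Δ := q.2.1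
    have hc : q.1.2.card = j + 1 + 1 := q.2.2
    simp only [LinearMap.comp_apply, Finsupp.lsingle_apply, ← faceChain_coe,
      LinearMap.zero_apply]
    generalize q.1.2 = H at hq hc
    rw [bd_faceChain, if_pos ⟨hq, hc⟩, map_sum]
    have hterm : ∀ y ∈ H, φ (faceSign K H y • faceChain K Δ (j + 1) (H.erase y)) =
        ∑ x ∈ H.erase y, if (H.erase y).erase x = G.erase w then
          faceSign K H y * faceSign K (H.erase y) x else 0 := by
      intro y hy
      have hcard : (H.erase y).card = j + 1 := by rw [Finset.card_erase_of_mem hy, hc]; rfl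
      rw [map_smul, linearCombination_faceChain c, smul_eq_mul]
      by_cases hm : H.erase y ∈ Δ
      · rw [if_pos ⟨hm, hcard⟩, Finset.mul_sum]
        exact Finset.sum_congr rfl fun x _ => by rw [mul_ite, mul_zero]
      · rw [if_neg fun hh => hm hh.1, mul_zero]
        symm
        refine Finset.sum_eq_zero fun x hx => if_neg fun hh => hm ?_
        have := hlink H hq x (Finset.mem_of_mem_erase hx) (hh ▸ Finset.notMem_erase _ _)
          (hh ▸ (Finset.erase_subset _ _).trans (Finset.erase_subset _ _))
        rwa [← hh, Finset.insert_erase hx] at this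
    rw [Finset.sum_congr rfl hterm, Finset.sum_sigma']
    refine Finset.sum_involution (fun p _ => ⟨p.2, p.1⟩) ?_ ?_ ?_ ?_
    · rintro ⟨y, x⟩ hp
      simp only [Finset.mem_sigma, Finset.mem_erase] at hp
      obtain ⟨hy, hxy, hx⟩ := hp
      simp only [Finset.erase_right_comm (a := x) (b := y)]
      split_ifs
      · rw [faceSign_mul_anticomm hy hx hxy.symm]
        ring
      · simp
    · rintro ⟨y, x⟩ hp _ heq
      simp only [Finset.mem_sigma, Finset.mem_erase] at hp
      simp only [Sigma.mk.injEq] at heq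
      exact hp.2.1 heq.1
    · rintro ⟨y, x⟩ hp
      simp only [Finset.mem_sigma, Finset.mem_erase] at hp ⊢
      exact ⟨hp.2.2, hp.2.1.symm, hp.1⟩
    · rintro ⟨y, x⟩ _
      rfl
  have hcyc : faceChain K Δ (j + 1) G ∈ cycles K (lab Δ) (j + 1) := by
    change bd K (lab Δ) j _ = 0
    rw [bd_faceChain, if_pos ⟨hG, hj⟩]
    refine Finset.sum_eq_zero fun u hu => ?_
    rw [faceChain_eq_zero (F := G.erase u) fun h => hfacet u hu h.1, smul_zero]
  have hnb : faceChain K Δ (j + 1) G ∉ LinearMap.range (bd K (lab Δ) (j + 1)) := by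
    rintro ⟨y, hy⟩
    have h0 : φ (faceChain K Δ (j + 1) G) = 0 := by
      rw [← hy]
      exact LinearMap.congr_fun hφ y
    rw [linearCombination_faceChain c, if_pos ⟨hG, hj⟩] at h0
    have h1 : c G = faceSign K G w := by
      change ∑ x ∈ G, _ = _
      rw [Finset.sum_eq_single w]
      · simp
      · intro x _ hxw
        refine if_neg fun hh => ?_
        exact Finset.notMem_erase w G (hh ▸ Finset.mem_erase.2 ⟨hxw.symm, hw⟩)
      · exact fun h => absurd hw h
    exact faceSign_ne_zero G w (h1 ▸ h0)
  rw [rhd0, rhd]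
  have hlt : LinearMap.range (bd K (lab Δ) (j + 1)) ⊓ cycles K (lab Δ) (j + 1) <
      cycles K (lab Δ) (j + 1) := by
    refine lt_of_le_of_ne inf_le_right fun h => hnb ?_
    rw [← h] at hcyc
    exact hcyc.1
  have := Submodule.finrank_lt_finrank_of_lt hlt
  omega

end Faces

/-! ### Monomials outside an invariant ideal -/

section Fits

variable {n : ℕ}

/-- Some rearrangement of `b` is componentwise at most `ρ`. -/
def Fits (b : Fin n → ℕ) (ρ : Fin n → ℕ∞) : Prop :=
  ∃ σ : Equiv.Perm (Fin n), ∀ i, (b (σ i) : ℕ∞) ≤ ρ i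

lemma Fits.mono {b b' : Fin n → ℕ} {ρ : Fin n → ℕ∞} (h : Fits b ρ) (hb : ∀ i, b' i ≤ b i) :
    Fits b' ρ := by
  obtain ⟨σ, hσ⟩ := h
  exact ⟨σ, fun i => le_trans (by exact_mod_cast hb (σ i)) (hσ i)⟩

variable (K : Type) [Field K]

lemma mon_mem_Qgen_iff (ρ : Fin n → ℕ∞) (b : Fin n → ℕ) :
    mon K n b ∈ Qgen K n ρ ↔ ¬ Fits b ρ := by
  unfold Qgen Fits
  rw [Ideal.mem_iInf]
  push Not
  refine forall_congr' fun σ => ?_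
  have himg : Ideal.map (MvPolynomial.rename σ).toRingHom
      (Ideal.span {g : MvPolynomial (Fin n) K |
        ∃ i : Fin n, ρ i ≠ ⊤ ∧ g = MvPolynomial.X i ^ ((ρ i).toNat + 1)}) =
      Ideal.span ((fun s => MvPolynomial.monomial s (1 : K)) ''
        {s | ∃ i : Fin n, ρ i ≠ ⊤ ∧ s = Finsupp.single (σ i) ((ρ i).toNat + 1)}) := by
    have hren : ∀ i, (MvPolynomial.rename σ).toRingHom
        (MvPolynomial.X i ^ ((ρ i).toNat + 1) : MvPolynomial (Fin n) K) =
        MvPolynomial.monomial (Finsupp.single (σ i) ((ρ i).toNat + 1)) 1 := fun i => by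
      rw [map_pow, ← MvPolynomial.X_pow_eq_monomial]
      exact congrArg (· ^ _) (MvPolynomial.rename_X _ _)
    rw [Ideal.map_span]
    congr 1
    ext g
    constructor
    · rintro ⟨_, ⟨i, hi, rfl⟩, rfl⟩
      exact ⟨_, ⟨i, hi, rfl⟩, (hren i).symm⟩
    · rintro ⟨_, ⟨i, hi, rfl⟩, rfl⟩
      exact ⟨_, ⟨i, hi, rfl⟩, hren i⟩
  rw [himg, mon, MvPolynomial.mem_ideal_span_monomial_image]
  have hsupp : (MvPolynomial.monomial (Finsupp.equivFunOnFinite.symm b) (1 : K)).support =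
      {Finsupp.equivFunOnFinite.symm b} := by
    rw [MvPolynomial.support_monomial, if_neg one_ne_zero]
  rw [hsupp]
  simp only [Finset.mem_singleton, forall_eq, Set.mem_ofPred_eq]
  constructor
  · rintro ⟨_, ⟨i, hi, rfl⟩, hle⟩
    refine ⟨i, ?_⟩
    rw [Finsupp.single_le_iff] at hle
    lift ρ i to ℕ using hi with r
    simp only [ENat.toNat_natCast, Finsupp.equivFunOnFinite_symm_apply_apply] at hle
    exact_mod_cast hle
  · rintro ⟨i, hi⟩
    have htop : ρ i ≠ ⊤ := ne_top_of_lt hi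
    refine ⟨_, ⟨i, htop, rfl⟩, ?_⟩
    rw [Finsupp.single_le_iff]
    lift ρ i to ℕ using htop with r
    simp only [ENat.toNat_natCast, Finsupp.equivFunOnFinite_symm_apply_apply]
    exact_mod_cast hi

lemma Qgen_anti {μ ρ : Fin n → ℕ∞} (h : ∀ i, μ i ≤ ρ i) : Qgen K n ρ ≤ Qgen K n μ := by
  refine iInf_mono fun σ => Ideal.map_mono (Ideal.span_le.2 ?_)
  rintro _ ⟨i, hi, rfl⟩
  have hle : (μ i).toNat ≤ (ρ i).toNat := ENat.toNat_le_toNat (h i) hi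
  refine Ideal.mem_of_dvd _ (pow_dvd_pow _ (Nat.add_le_add_right hle 1)) (Ideal.subset_span ?_)
  exact ⟨i, ne_top_of_le_ne_top hi (h i), rfl⟩

lemma Qgen_eq_bot {μ : Fin n → ℕ∞} (h : ∀ i, μ i = ⊤) : Qgen K n μ = ⊥ := by
  rw [eq_bot_iff]
  refine (iInf_le _ (1 : Equiv.Perm (Fin n))).trans ?_
  simp [h]

variable {K} {I : Ideal (MvPolynomial (Fin n) K)} {Λ : Finset (Fin n → ℕ∞)}

lemma IsDualPresentation.mon_notMem_iff (hpres : IsDualPresentation K n I Λ) (b : Fin n → ℕ) :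
    mon K n b ∉ I ↔ ∃ ρ ∈ Λ, Fits b ρ := by
  rw [hpres.2.1]
  simp only [Ideal.mem_iInf, mon_mem_Qgen_iff]
  push Not
  rfl

lemma IsDualPresentation.eq_of_le (hpres : IsDualPresentation K n I Λ) {μ ρ : Fin n → ℕ∞}
    (hμ : μ ∈ Λ) (hρ : ρ ∈ Λ) (h : ∀ i, μ i ≤ ρ i) : ρ = μ := by
  by_contra hne
  apply hpres.2.2 μ hμ
  refine le_antisymm ?_ ?_
  · rw [hpres.2.1]
    exact iInf₂_mono fun ν _ => le_iInf fun _ => le_rfl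
  · conv_rhs => rw [hpres.2.1]
    refine le_iInf₂ fun ν hν => ?_
    by_cases hνμ : ν = μ
    · subst hνμ
      exact (iInf₂_le ρ hρ).trans ((iInf_le _ hne).trans (Qgen_anti K h))
    · exact (iInf₂_le ν hν).trans (iInf_le _ hνμ)

lemma IsDualPresentation.exists_ne_top (hpres : IsDualPresentation K n I Λ) (hne : I ≠ ⊥)
    {μ : Fin n → ℕ∞} (hμ : μ ∈ Λ) : ∃ i, μ i ≠ ⊤ := by
  by_contra! h
  apply hne
  rw [eq_bot_iff, hpres.2.1]
  exact (iInf₂_le μ hμ).trans (Qgen_eq_bot K h).le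

lemma IsDualPresentation.nonempty (hpres : IsDualPresentation K n I Λ) (hproper : I ≠ ⊤) :
    Λ.Nonempty := by
  rw [Finset.nonempty_iff_ne_empty]
  rintro rfl
  exact hproper (by simpa using hpres.2.1)

end Fits

/-! ### Combinatorics of extended partitions -/

section Combinatorics

variable {n : ℕ}

lemma toNat_le_topVal (μ : Fin n → ℕ∞) (i : Fin n) : (μ i).toNat ≤ topVal n μ :=
  Finset.le_sup (f := fun i => (μ i).toNat) (Finset.mem_univ i)

lemma plusOf_of_eq_top {μ : Fin n → ℕ∞} {i : Fin n} (h : μ i = ⊤) :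
    plusOf n μ i = topVal n μ + 1 := if_pos h

lemma plusOf_of_ne_top {μ : Fin n → ℕ∞} {i : Fin n} (h : μ i ≠ ⊤) :
    plusOf n μ i = (μ i).toNat := if_neg h

lemma plusOf_le (μ : Fin n → ℕ∞) (i : Fin n) : (plusOf n μ i : ℕ∞) ≤ μ i := by
  by_cases h : μ i = ⊤
  · simp [h]
  · rw [plusOf_of_ne_top h, ENat.natCast_toNat h]

lemma plusOf_le_topVal (μ : Fin n → ℕ∞) (i : Fin n) : plusOf n μ i ≤ topVal n μ + 1 := by
  have := toNat_le_topVal μ i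
  unfold plusOf
  split_ifs <;> omega

lemma antitone_plusOf {μ : Fin n → ℕ∞} (h : Antitone μ) : Antitone (plusOf n μ) := by
  intro i j hij
  by_cases hi : μ i = ⊤
  · rw [plusOf_of_eq_top hi]
    exact plusOf_le_topVal μ j
  · have hj : μ j ≠ ⊤ := ne_top_of_le_ne_top hi (h hij)
    rw [plusOf_of_ne_top hi, plusOf_of_ne_top hj]
    exact ENat.toNat_le_toNat (h hij) hi

lemma exists_toNat_eq_topVal {μ : Fin n → ℕ∞} (h : ∃ i, μ i ≠ ⊤) :
    ∃ w, μ w ≠ ⊤ ∧ (μ w).toNat = topVal n μ := by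
  obtain ⟨i, hi⟩ := h
  obtain ⟨w, -, hw⟩ := Finset.exists_mem_eq_sup Finset.univ ⟨i, Finset.mem_univ i⟩
    fun i => (μ i).toNat
  by_cases hwt : μ w = ⊤
  · refine ⟨i, hi, ?_⟩
    have h0 : topVal n μ = 0 := by
      unfold topVal
      rw [hw, hwt]
      rfl
    have := toNat_le_topVal μ i
    omega
  · exact ⟨w, hwt, hw.symm⟩

lemma Fits.le_of_antitone {b : Fin n → ℕ} {ρ : Fin n → ℕ∞} (h : Fits b ρ) (hb : Antitone b)
    (hρ : Antitone ρ) (i : Fin n) : (b i : ℕ∞) ≤ ρ i := by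
  obtain ⟨σ, hσ⟩ := h
  obtain ⟨j, hij, hj⟩ : ∃ j, i ≤ j ∧ σ j ≤ i := by
    by_contra! hcon
    have hsub : (Finset.Ici i).map σ.toEmbedding ⊆ Finset.Ioi i := by
      intro t ht
      obtain ⟨j, hj, rfl⟩ := Finset.mem_map.1 ht
      exact Finset.mem_Ioi.2 (hcon j (Finset.mem_Ici.1 hj))
    have hcard := Finset.card_le_card hsub
    rw [Finset.card_map, Fin.card_Ici, Fin.card_Ioi] at hcard
    omega
  exact le_trans (by exact_mod_cast hb hj) ((hσ j).trans (hρ hij))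

lemma sum_eF {F : Finset ℕ} (hF : F ⊆ Finset.range n) : ∑ t : Fin n, eF F t = F.card := by
  rw [← Finset.sum_range (fun j => eF F j)]
  simp [eF, Finset.inter_eq_right.2 hF]

lemma sum_sub_eF {F : Finset ℕ} {a : Fin n → ℕ} (hF : F ⊆ Finset.range n)
    (ha : ∀ i : Fin n, (i : ℕ) ∈ F → 1 ≤ a i) :
    ∑ t, (a t - eF F t) + F.card = ∑ t, a t := by
  rw [← sum_eF hF, ← Finset.sum_add_distrib]
  refine Finset.sum_congr rfl fun t _ => Nat.sub_add_cancel ?_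
  unfold eF
  split_ifs with h
  · exact ha t h
  · exact Nat.zero_le _

lemma sub_eF_erase {F : Finset ℕ} (a : Fin n → ℕ) {v t : Fin n} (h : t ≠ v) :
    a t - eF (F.erase v) t = a t - eF F t := by
  have : (t : ℕ) ≠ v := fun h' => h (Fin.ext h')
  simp [eF, this]

lemma Fits.erase_of_sum_lt {a : Fin n → ℕ} {F : Finset ℕ} {v : Fin n} {ρ : Fin n → ℕ∞}
    (hmax : ∀ t, a t ≤ a v) (hv : (v : ℕ) ∈ F) (h : Fits (fun t => a t - eF F t) ρ)
    (hsum : ∑ t, plusOf n ρ t < ∑ t, (a t - eF F t)) :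
    Fits (fun t => a t - eF (F.erase v) t) ρ := by
  obtain ⟨σ, hσ⟩ := h
  refine ⟨σ, fun i => ?_⟩
  by_cases hi : σ i = v
  · suffices ht : ρ i = ⊤ by simp [ht]
    by_contra ht
    refine absurd hsum (not_lt.2 ?_)
    have hvi : a v - 1 ≤ topVal n ρ := by
      have h1 := hσ i
      rw [hi, ← ENat.natCast_toNat ht] at h1
      simp only [eF, if_pos hv, Nat.cast_le] at h1
      exact h1.trans (toNat_le_topVal ρ i)
    rw [← Equiv.sum_comp σ]
    refine Finset.sum_le_sum fun j _ => ?_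
    by_cases hj : ρ j = ⊤
    · rw [plusOf_of_eq_top hj]
      have := hmax (σ j)
      omega
    · rw [plusOf_of_ne_top hj]
      have h1 := hσ j
      rw [← ENat.natCast_toNat hj] at h1
      exact_mod_cast h1
  · have := hσ i
    simp only [sub_eF_erase a hi]
    exact this

lemma Fits.erase_of_lt_ellInf {a : Fin n → ℕ} {F : Finset ℕ} {v : Fin n} {ρ : Fin n → ℕ∞}
    (hF : F ⊆ Finset.range n) (hmax : ∀ t, a t ≤ a v) (hv : (v : ℕ) ∈ F)
    (h : Fits (fun t => a t - eF F t) ρ) (hell : n - ellInf n ρ < F.card) :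
    Fits (fun t => a t - eF (F.erase v) t) ρ := by
  obtain ⟨σ, hσ⟩ := h
  obtain ⟨i, rfl⟩ := σ.surjective v
  obtain ⟨j, hj, hjF⟩ : ∃ j, ρ j = ⊤ ∧ ((σ j : Fin n) : ℕ) ∈ F := by
    by_contra! hcon
    have hsub : ((Finset.univ.filter fun j => ρ j = ⊤).map σ.toEmbedding).map Fin.valEmbedding ⊆
        Finset.range n \ F := by
      intro t ht
      simp only [Finset.mem_map, Finset.mem_filter, Finset.mem_univ, true_and] at ht
      obtain ⟨_, ⟨j, hj, rfl⟩, rfl⟩ := ht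
      exact Finset.mem_sdiff.2 ⟨Finset.mem_range.2 (σ j).2, hcon j hj⟩
    have hcard := Finset.card_le_card hsub
    rw [Finset.card_map, Finset.card_map, Finset.card_sdiff_of_subset hF,
      Finset.card_range] at hcard
    have hle := Finset.card_le_card hF
    rw [Finset.card_range] at hle
    unfold ellInf at hell
    omega
  by_cases hi : ρ i = ⊤
  · refine ⟨σ, fun t => ?_⟩
    by_cases ht : t = i
    · simp [ht, hi]
    · simp only [sub_eF_erase a (σ.injective.ne ht)]
      exact hσ t
  · have hij : i ≠ j := fun h => hi (h ▸ hj)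
    refine ⟨(Equiv.swap i j).trans σ, fun t => ?_⟩
    by_cases ht : t = j
    · simp [ht, hj]
    by_cases hti : t = i
    · subst hti
      simp only [Equiv.trans_apply, Equiv.swap_apply_left, sub_eF_erase a (σ.injective.ne hij.symm)]
      refine le_trans ?_ (hσ t)
      have h1 := hmax (σ j)
      simp only [eF, if_pos hjF, if_pos hv, Nat.cast_le]
      omega
    · simp only [Equiv.trans_apply, Equiv.swap_apply_of_ne_of_ne hti ht,
        sub_eF_erase a (σ.injective.ne hti)]
      exact hσ t

lemma not_fits_plusOf_add_single (μ : Fin n → ℕ∞) {u : Fin n} (hu : μ u ≠ ⊤) :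
    ¬ Fits (fun t => plusOf n μ t + if t = u then 1 else 0) μ := by
  rintro ⟨σ, hσ⟩
  set b : Fin n → ℕ := fun t => plusOf n μ t + if t = u then 1 else 0 with hb
  set m : ℕ := (μ u).toNat + 1 with hm
  have hsub : (Finset.univ.filter fun i => m ≤ b i) ⊆
      (Finset.univ.filter fun i => (m : ℕ∞) ≤ μ i).map σ.toEmbedding := by
    intro t ht
    refine Finset.mem_map.2 ⟨σ.symm t, ?_, by simp⟩
    have h1 := hσ (σ.symm t)
    rw [Equiv.apply_symm_apply] at h1
    have h2 : m ≤ b t := (Finset.mem_filter.1 ht).2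
    exact Finset.mem_filter.2 ⟨Finset.mem_univ _, le_trans (by exact_mod_cast h2) h1⟩
  have hnot : u ∉ Finset.univ.filter fun i => (m : ℕ∞) ≤ μ i := by
    simp only [Finset.mem_filter, Finset.mem_univ, true_and, not_le]
    rw [← ENat.natCast_toNat hu]
    exact_mod_cast Nat.lt_succ_self _
  have hsup : insert u (Finset.univ.filter fun i => (m : ℕ∞) ≤ μ i) ⊆
      Finset.univ.filter fun i => m ≤ b i := by
    intro t ht
    rcases Finset.mem_insert.1 ht with rfl | ht
    · simp [hb, hm, plusOf_of_ne_top hu]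
    · have h1 : (m : ℕ∞) ≤ μ t := (Finset.mem_filter.1 ht).2
      refine Finset.mem_filter.2 ⟨Finset.mem_univ _, le_trans ?_ (Nat.le_add_right _ _)⟩
      by_cases htt : μ t = ⊤
      · rw [plusOf_of_eq_top htt]
        have := toNat_le_topVal μ u
        omega
      · rw [plusOf_of_ne_top htt]
        rw [← ENat.natCast_toNat htt] at h1
        exact_mod_cast h1
  have hcard := Finset.card_le_card (hsup.trans hsub)
  rw [Finset.card_map, Finset.card_insert_of_notMem hnot] at hcard
  omega

lemma ellInf_lt_and_sum_lt_of_fits {μ ρ : Fin n → ℕ∞} (hμ : Antitone μ) (hρ : Antitone ρ)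
    (hnle : ¬ ∀ i, μ i ≤ ρ i) {u : Fin n}
    (h : Fits (fun t => plusOf n μ t + if t = u then 1 else 0) ρ) :
    ellInf n ρ < ellInf n μ ∧ ∑ t, plusOf n μ t < ∑ t, plusOf n ρ t := by
  have hle : ∀ i, (plusOf n μ i : ℕ∞) ≤ ρ i :=
    (h.mono fun i => Nat.le_add_right _ _).le_of_antitone (antitone_plusOf hμ) hρ
  push Not at hnle
  obtain ⟨i, hi⟩ := hnle
  have hμi : μ i = ⊤ := by
    by_contra hcon
    have := hle i
    rw [plusOf_of_ne_top hcon, ENat.natCast_toNat hcon] at this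
    exact absurd hi (not_lt.2 this)
  have hρi : ρ i ≠ ⊤ := ne_top_of_lt hi
  constructor
  · refine Finset.card_lt_card (Finset.ssubset_iff_of_subset ?_ |>.2 ⟨i, ?_, ?_⟩)
    · intro j hj
      have hρj : ρ j = ⊤ := (Finset.mem_filter.1 hj).2
      have hji : j ≤ i := by
        by_contra! hcon
        have := hρ hcon.le
        rw [hρj] at this
        exact hρi (top_le_iff.1 this)
      have := hμ hji
      rw [hμi] at this
      exact Finset.mem_filter.2 ⟨Finset.mem_univ _, top_le_iff.1 this⟩
    · simp [hμi]
    · simp [hρi]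
  · have htop : topVal n μ + 1 ≤ topVal n ρ := by
      have h1 := hle i
      rw [plusOf_of_eq_top hμi, ← ENat.natCast_toNat hρi] at h1
      exact le_trans (by exact_mod_cast h1) (toNat_le_topVal ρ i)
    obtain ⟨σ, hσ⟩ := h
    have hsum : ∑ t, (plusOf n μ t + if t = u then 1 else 0) ≤ ∑ t, plusOf n ρ t := by
      rw [← Equiv.sum_comp σ]
      refine Finset.sum_le_sum fun j _ => ?_
      by_cases hj : ρ j = ⊤
      · rw [plusOf_of_eq_top hj]
        have := plusOf_le_topVal μ (σ j)
        split_ifs <;> omega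
      · rw [plusOf_of_ne_top hj]
        have h1 := hσ j
        rw [← ENat.natCast_toNat hj] at h1
        exact_mod_cast h1
    rw [Finset.sum_add_distrib, Finset.sum_ite_eq' Finset.univ u, if_pos (Finset.mem_univ u)]
      at hsum
    omega

end Combinatorics

/-! ### Vanishing and nonvanishing of Tor -/

section TorBounds

variable {K : Type} [Field K] {n : ℕ} {I : Ideal (MvPolynomial (Fin n) K)}
  {Λ : Finset (Fin n → ℕ∞)}

lemma IsDualPresentation.mem_KosQ_iff (hpres : IsDualPresentation K n I Λ) (a : Fin n → ℕ)
    (F : Finset ℕ) :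
    F ∈ KosQ K n I a ↔ F ⊆ Finset.range n ∧ (∀ i : Fin n, (i : ℕ) ∈ F → 1 ≤ a i) ∧
      ∃ ρ ∈ Λ, Fits (fun t => a t - eF F t) ρ := by
  rw [← hpres.mon_notMem_iff]
  rfl

/-- `Tor_i(R/I, K)_a` vanishes for `a ≠ 0` as soon as faces of size `i` stay faces after removal
of any vertex at which `a` is maximal. -/
lemma IsDualPresentation.torQDim_eq_zero (hpres : IsDualPresentation K n I Λ) {i : ℕ}
    {a : Fin n → ℕ} (ha : ∃ t, a t ≠ 0)
    (herase : ∀ (F : Finset ℕ) (v : Fin n), F ⊆ Finset.range n → F.card = i →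
      (∀ t : Fin n, (t : ℕ) ∈ F → 1 ≤ a t) → (v : ℕ) ∈ F → (∀ t, a t ≤ a v) →
      ∀ ρ ∈ Λ, Fits (fun t => a t - eF F t) ρ → Fits (fun t => a t - eF (F.erase v) t) ρ) :
    torQDim K n I i a = 0 := by
  obtain ⟨t, ht⟩ := ha
  obtain ⟨v, -, hv⟩ := Finset.exists_max_image Finset.univ a ⟨t, Finset.mem_univ t⟩
  have hmax : ∀ s, a s ≤ a v := fun s => hv s (Finset.mem_univ s)
  have hpos : 1 ≤ a v := by
    have := hmax t
    omega
  refine rhd0_eq_zero_of_cone (v := (v : ℕ)) ?_ ?_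
  · intro F hF _
    rw [hpres.mem_KosQ_iff] at hF ⊢
    obtain ⟨hsub, hone, ρ, hρ, hfit⟩ := hF
    refine ⟨Finset.insert_subset (Finset.mem_range.2 v.2) hsub, ?_, ρ, hρ, hfit.mono ?_⟩
    · intro s hs
      rcases Finset.mem_insert.1 hs with hs | hs
      · rwa [Fin.ext hs]
      · exact hone s hs
    · intro s
      refine Nat.sub_le_sub_left ?_ _
      unfold eF
      by_cases h : (s : ℕ) ∈ F <;> simp [h]
  · intro F hF hcard hvF
    rw [hpres.mem_KosQ_iff] at hF ⊢
    obtain ⟨hsub, hone, ρ, hρ, hfit⟩ := hF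
    exact ⟨(Finset.erase_subset _ _).trans hsub,
      fun s hs => hone s (Finset.mem_of_mem_erase hs), ρ, hρ,
      herase F v hsub hcard hone hvF hmax ρ hρ hfit⟩

lemma IsDualPresentation.index_eq_zero_of_torQDim_ne_zero (hpres : IsDualPresentation K n I Λ) {i : ℕ}
    {a : Fin n → ℕ} (ha : ∀ t, a t = 0) (h : torQDim K n I i a ≠ 0) : i = 0 := by
  obtain ⟨F, hF, rfl⟩ := exists_face_of_rhd0_ne_zero h
  rw [hpres.mem_KosQ_iff] at hF
  rw [Finset.card_eq_zero, Finset.eq_empty_iff_forall_notMem]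
  intro x hx
  have := hF.2.1 ⟨x, Finset.mem_range.1 (hF.1 hx)⟩ hx
  rw [ha] at this
  omega

lemma IsDualPresentation.exists_sum_le (hpres : IsDualPresentation K n I Λ) (hΛ : Λ.Nonempty)
    {i : ℕ} {a : Fin n → ℕ} (h : torQDim K n I i a ≠ 0) :
    ∃ μ ∈ Λ, ∑ t, a t ≤ ∑ t, plusOf n μ t + i := by
  by_contra! hcon
  obtain ⟨μ, hμ⟩ := hΛ
  refine h (hpres.torQDim_eq_zero ?_ ?_)
  · by_contra! ha
    have := hcon μ hμ
    simp [ha] at this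
  · intro F v hsub hcard hone hv hmax ρ hρ hfit
    refine hfit.erase_of_sum_lt hmax hv ?_
    have h1 := sum_sub_eF hsub hone
    have h2 := hcon ρ hρ
    omega

lemma IsDualPresentation.exists_le_sub_ellInf (hpres : IsDualPresentation K n I Λ)
    (hΛ : Λ.Nonempty) {i : ℕ} {a : Fin n → ℕ} (h : torQDim K n I i a ≠ 0) :
    ∃ μ ∈ Λ, i ≤ n - ellInf n μ := by
  by_contra! hcon
  obtain ⟨μ, hμ⟩ := hΛ
  refine h (hpres.torQDim_eq_zero ?_ ?_)
  · by_contra! ha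
    have := hcon μ hμ
    have := hpres.index_eq_zero_of_torQDim_ne_zero ha h
    omega
  · intro F v hsub hcard _ hv hmax ρ hρ hfit
    exact hfit.erase_of_lt_ellInf hsub hmax hv (hcard ▸ hcon ρ hρ)

lemma tildeOf_pos (μ : Fin n → ℕ∞) (i : Fin n) : 1 ≤ tildeOf n μ i := by
  unfold tildeOf
  split_ifs <;> omega

/-- The positions of the finite entries of `μ`. -/
def finitePositions (μ : Fin n → ℕ∞) : Finset ℕ :=
  (Finset.univ.filter fun i => μ i ≠ ⊤).map Fin.valEmbedding

lemma coe_mem_finitePositions {μ : Fin n → ℕ∞} {i : Fin n} :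
    (i : ℕ) ∈ finitePositions μ ↔ μ i ≠ ⊤ := by
  simp [finitePositions, Fin.val_inj]

lemma finitePositions_subset (μ : Fin n → ℕ∞) : finitePositions μ ⊆ Finset.range n := by
  intro x hx
  obtain ⟨i, _, rfl⟩ := Finset.mem_map.1 hx
  exact Finset.mem_range.2 i.2

lemma card_finitePositions (μ : Fin n → ℕ∞) : (finitePositions μ).card = n - ellInf n μ := by
  have h := Finset.card_filter_add_card_filter_not (s := (Finset.univ : Finset (Fin n)))
    (fun i => μ i = ⊤)
  rw [Finset.card_univ, Fintype.card_fin] at h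
  unfold finitePositions ellInf
  rw [Finset.card_map]
  simp only [ne_eq]
  omega

lemma tildeOf_sub_eF (μ : Fin n → ℕ∞) (i : Fin n) :
    tildeOf n μ i - eF (finitePositions μ) i = plusOf n μ i := by
  by_cases h : μ i = ⊤ <;> simp [eF, coe_mem_finitePositions, tildeOf, plusOf, h]

lemma sum_tildeOf (μ : Fin n → ℕ∞) :
    ∑ t, tildeOf n μ t = ∑ t, plusOf n μ t + (n - ellInf n μ) := by
  rw [← card_finitePositions, ← sum_sub_eF (finitePositions_subset μ)
    fun i _ => tildeOf_pos μ i]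
  simp only [tildeOf_sub_eF]

lemma IsDualPresentation.torQDim_tildeOf_ne_zero (hpres : IsDualPresentation K n I Λ)
    (hne : I ≠ ⊥) {μ : Fin n → ℕ∞} (hμ : μ ∈ Λ)
    (hext : ∀ ρ ∈ Λ, ellInf n ρ < ellInf n μ →
      ¬ ∑ t, plusOf n μ t < ∑ t, plusOf n ρ t) :
    torQDim K n I (n - ellInf n μ) (tildeOf n μ) ≠ 0 := by
  obtain ⟨w, hw, hwtop⟩ := exists_toNat_eq_topVal (hpres.exists_ne_top hne hμ)
  have hwG : (w : ℕ) ∈ finitePositions μ := coe_mem_finitePositions.2 hw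
  rw [← card_finitePositions]
  refine rhd0_ne_zero_of_facets (w := (w : ℕ)) ?_ ?_ hwG ?_ ?_
  · exact (Finset.range n).powerset.finite_toSet.subset fun F hF =>
      Finset.mem_coe.2 (Finset.mem_powerset.2 hF.1)
  · rw [hpres.mem_KosQ_iff]
    refine ⟨finitePositions_subset μ, fun i _ => tildeOf_pos μ i, μ, hμ, 1, fun i => ?_⟩
    simp only [tildeOf_sub_eF]
    exact plusOf_le μ i
  · intro u hu hmem
    obtain ⟨u, hu', rfl⟩ := Finset.mem_map.1 hu
    have hut : μ u ≠ ⊤ := (Finset.mem_filter.1 hu').2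
    rw [hpres.mem_KosQ_iff] at hmem
    obtain ⟨-, -, ρ, hρ, hfit⟩ := hmem
    have hfit' : Fits (fun t => plusOf n μ t + if t = u then 1 else 0) ρ := by
      refine hfit.mono fun t => ?_
      by_cases ht : t = u
      · subst ht
        simp [eF, tildeOf, plusOf, hut]
      · simp only [Fin.valEmbedding_apply]
        rw [sub_eF_erase _ ht, tildeOf_sub_eF, if_neg ht, add_zero]
    by_cases hle : ∀ i, μ i ≤ ρ i
    · rw [hpres.eq_of_le hμ hρ hle] at hfit'
      exact not_fits_plusOf_add_single μ hut hfit'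
    · obtain ⟨h1, h2⟩ := ellInf_lt_and_sum_lt_of_fits (hpres.1 μ hμ) (hpres.1 ρ hρ) hle hfit'
      exact hext ρ hρ h1 h2
  · intro H hH x hx hxG _
    have hxn : x < n := Finset.mem_range.1 (hH.1 hx)
    obtain ⟨x, rfl⟩ : ∃ y : Fin n, (y : ℕ) = x := ⟨⟨x, hxn⟩, rfl⟩
    have hx' : x = w ∨ μ x = ⊤ := by
      by_contra! hcon
      exact hxG (Finset.mem_erase.2
        ⟨fun h => hcon.1 (Fin.ext h), coe_mem_finitePositions.2 hcon.2⟩)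
    rw [hpres.mem_KosQ_iff]
    refine ⟨Finset.insert_subset (Finset.mem_range.2 hxn)
      ((Finset.erase_subset _ _).trans (finitePositions_subset μ)),
      fun i _ => tildeOf_pos μ i, μ, hμ, Equiv.swap x w, fun i => ?_⟩
    refine le_trans (le_of_eq ?_) (plusOf_le μ i)
    rw [Nat.cast_inj]
    rcases hx' with rfl | hxt
    · rw [Finset.insert_erase hwG, Equiv.swap_self]
      exact tildeOf_sub_eF μ i
    · have hxw : x ≠ w := fun h => hw (h ▸ hxt)
      have hxw' : (x : ℕ) ≠ w := fun h => hxw (Fin.ext h)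
      by_cases hix : i = x
      · subst hix
        simp [eF, tildeOf, plusOf, hxt, hw, hwtop, hxw'.symm]
      by_cases hiw : i = w
      · subst hiw
        simp [eF, tildeOf, plusOf, hxt, hw, hwtop]
      · have hix' : (i : ℕ) ≠ x := fun h => hix (Fin.ext h)
        have hiw' : (i : ℕ) ≠ w := fun h => hiw (Fin.ext h)
        rw [Equiv.swap_apply_of_ne_of_ne hix hiw, ← tildeOf_sub_eF]
        simp [eF, hix', hiw']

end TorBounds

/-- For a nonzero, proper `S_n`-invariant monomial ideal `I`:
(i) `reg(R/I) = max{|μ^+| : μ ∈ Λ*(I)}`, where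
`reg(R/I) = max{j - i : Tor_i(R/I, k)_j ≠ 0}` (standard grading: `Tor_i(R/I,k)_j ≠ 0`
iff some multidegree `a` with `|a| = j` has `Tor_i(R/I,k)_a ≠ 0`);
(ii) `pd(R/I) = max{n - ℓ(μ) : μ ∈ Λ*(I)}`, where `pd(R/I) = max{i : Tor_i(R/I,k) ≠ 0}`. -/
theorem statement_14 (K : Type) [Field K] (n : ℕ) (I : Ideal (MvPolynomial (Fin n) K))
    (hmon : IsMonomialIdeal K n I) (hsym : IsSymmetricIdeal K n I)
    (hne : I ≠ ⊥) (hproper : I ≠ ⊤)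
    (Λ : Finset (Fin n → ℕ∞)) (hpres : IsDualPresentation K n I Λ) :
    (∃ reg : ℤ,
      IsGreatest {m : ℤ | ∃ (i : ℕ) (a : Fin n → ℕ),
          torQDim K n I i a ≠ 0 ∧ m = (∑ t, (a t : ℤ)) - i} reg ∧
      IsGreatest {m : ℤ | ∃ μ ∈ Λ, m = ∑ t : Fin n, (plusOf n μ t : ℤ)} reg) ∧
    (∃ pd : ℕ,
      IsGreatest {i : ℕ | ∃ a : Fin n → ℕ, torQDim K n I i a ≠ 0} pd ∧
      IsGreatest {m : ℕ | ∃ μ ∈ Λ, m = n - ellInf n μ} pd) := by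
  have hΛ := hpres.nonempty hproper
  refine ⟨?_, ?_⟩
  · obtain ⟨μ, hμ, hmax⟩ := Finset.exists_max_image Λ (fun μ => ∑ t, plusOf n μ t) hΛ
    refine ⟨∑ t, (plusOf n μ t : ℤ), ⟨⟨n - ellInf n μ, tildeOf n μ, ?_, ?_⟩, ?_⟩,
      ⟨μ, hμ, rfl⟩, ?_⟩
    · exact hpres.torQDim_tildeOf_ne_zero hne hμ fun ρ hρ _ => not_lt.2 (hmax ρ hρ)
    · have h : (∑ t, (tildeOf n μ t : ℤ)) =
          ∑ t, (plusOf n μ t : ℤ) + ((n - ellInf n μ : ℕ) : ℤ) := by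
        exact_mod_cast sum_tildeOf μ
      rw [h, add_sub_cancel_right]
    · rintro _ ⟨i, a, hia, rfl⟩
      obtain ⟨ρ, hρ, hle⟩ := hpres.exists_sum_le hΛ hia
      have h : (∑ t, (a t : ℤ)) ≤ ∑ t, (plusOf n μ t : ℤ) + i := by
        exact_mod_cast hle.trans (Nat.add_le_add_right (hmax ρ hρ) i)
      linarith
    · rintro _ ⟨ρ, hρ, rfl⟩
      exact_mod_cast hmax ρ hρ
  · obtain ⟨μ, hμ, hmin⟩ := Finset.exists_min_image Λ (ellInf n) hΛ
    refine ⟨n - ellInf n μ, ⟨⟨tildeOf n μ, ?_⟩, ?_⟩, ⟨μ, hμ, rfl⟩, ?_⟩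
    · exact hpres.torQDim_tildeOf_ne_zero hne hμ fun ρ hρ h => absurd h (not_lt.2 (hmin ρ hρ))
    · rintro i ⟨a, hia⟩
      obtain ⟨ρ, hρ, hle⟩ := hpres.exists_le_sub_ellInf hΛ hia
      exact hle.trans (Nat.sub_le_sub_left (hmin ρ hρ) n)
    · rintro _ ⟨ρ, hρ, rfl⟩
      exact Nat.sub_le_sub_left (hmin ρ hρ) n
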